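/- Let V be a separable Hilbert space, T > 0, and let {V_t}_{t∈[0,T]} be a family of closed linear subspaces of V that is increasing: V_s ⊆ V_t whenever 0 ≤ s ≤ t ≤ T. Then there exists a countable set S ⊂ [0,T] such that for all t ∈ [0,T] \ S, V_t equals the closure of ⋃_{s<t} V_s. -/

import Mathlib

/-- For an increasing family `{V_t}_{t∈[0,T]}` of closed linear subspaces of a separable
Hilbert space, there is a countable set `S ⊂ [0,T]` such that for every
`t ∈ [0,T] \ S`, `V_t` is the closure of `⋃_{s<t} V_s`. -/
theorem increasing_subspaces_countable_exceptional
    {V : Type*} [NormedAddCommGroup V] [InnerProductSpace ℝ V] [CompleteSpace V]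
    [TopologicalSpace.SeparableSpace V]
    (T : ℝ) (hT : 0 < T) (Vt : ℝ → Submodule ℝ V)
    (hclosed : ∀ t ∈ Set.Icc 0 T, IsClosed (Vt t : Set V))
    (hmono : ∀ s t : ℝ, 0 ≤ s → s ≤ t → t ≤ T → Vt s ≤ Vt t) :
    ∃ S : Set ℝ, S.Countable ∧ S ⊆ Set.Icc 0 T ∧
      ∀ t ∈ Set.Icc 0 T, t ∉ S →
        (Vt t : Set V) = closure (⋃ s ∈ Set.Ico 0 t, (Vt s : Set V)) := by
  classical
  haveI : SecondCountableTopology V := UniformSpace.secondCountable_of_separable V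
  set U : ℝ → Set V := fun t => ⋃ s ∈ Set.Ico 0 t, (Vt s : Set V) with hU
  let S : Set ℝ := {t | t ∈ Set.Icc 0 T ∧ (Vt t : Set V) ≠ closure (U t)}
  refine ⟨S, ?_, fun t ht => ht.1, fun t ht hS => ?_⟩
  · -- each exceptional time gets a basic open set meeting `V_t` but missing `V_s` for `s < t`
    have key : ∀ t ∈ S, ∃ b ∈ TopologicalSpace.countableBasis V,
        (∃ x ∈ b, x ∈ Vt t) ∧ ∀ s, 0 ≤ s → s < t → ∀ x ∈ b, x ∉ Vt s := by
      rintro t ⟨ht, hne⟩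
      have hsub : closure (U t) ⊆ (Vt t : Set V) := by
        refine closure_minimal ?_ (hclosed t ht)
        refine Set.iUnion₂_subset fun s hs => ?_
        exact hmono s t hs.1 hs.2.le ht.2
      have hns : ¬ (Vt t : Set V) ⊆ closure (U t) := fun h => hne (h.antisymm hsub)
      obtain ⟨x, hx, hxn⟩ := Set.not_subset.1 hns
      obtain ⟨b, hb, hxb, hbs⟩ :=
        (TopologicalSpace.isBasis_countableBasis V).exists_subset_of_mem_open
          (show x ∈ (closure (U t))ᶜ from hxn) isClosed_closure.isOpen_compl
      refine ⟨b, hb, ⟨x, hxb, hx⟩, fun s hs0 hst y hy hys => ?_⟩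
      exact hbs hy (subset_closure (Set.mem_biUnion (show s ∈ Set.Ico 0 t from ⟨hs0, hst⟩) hys))
    choose! f hf hmeet hmiss using key
    refine Set.MapsTo.countable_of_injOn (f := f) (t := TopologicalSpace.countableBasis V)
      hf ?_ (TopologicalSpace.countable_countableBasis V)
    intro t ht t' ht' heq
    rcases lt_trichotomy t t' with h | h | h
    · obtain ⟨x, hxb, hx⟩ := hmeet t ht
      exact absurd hx (hmiss t' ht' t ht.1.1 h x (heq ▸ hxb))
    · exact h
    · obtain ⟨x, hxb, hx⟩ := hmeet t' ht'
      exact absurd hx (hmiss t ht t' ht'.1.1 h x (heq ▸ hxb))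
  · by_contra hne
    exact hS ⟨ht, hne⟩
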